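/- Let s > 0, 0 ≤ ε < min{s, 3/4}, set γ(ε) = max{1/4 + (ε−s)/2, ε − 1/2, 0}, and let σ be any real number with γ(ε) + 1/2 < σ < 1. Then there exists C > 0 such that for all measurable f₁, f₂, f₃ : ℝ → ℂ with N_{s+1}(fⱼ) < ∞, the phase-weighted function h : ℝ → ℂ defined by h(ξ) = 1_{ξ>1} ∫∫_{{(ξ₁,ξ₂) : ξ₁ > ξ}} ⟨Φ(ξ,ξ₁,ξ₂)⟩^{−σ} (ξ₂+ξ₃) ξ₃ f₁(ξ₁) f₂(ξ₂) f₃(ξ₃) dξ₁ dξ₂ (with ξ₃ = ξ − ξ₁ − ξ₂) satisfies N_{s+ε+1}(h) ≤ C N_{s+1}(f₁) N_{s+1}(f₂) N_{s+1}(f₃). -/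

import Mathlib

open MeasureTheory Real
open scoped ENNReal

/-- Japanese bracket `⟨ξ⟩ = (1+ξ²)^{1/2}`. -/
noncomputable def jap (ξ : ℝ) : ℝ := Real.sqrt (1 + ξ ^ 2)

/-- Frequency-side Sobolev norm `N_σ(f) = (∫ ⟨ξ⟩^{2σ} |f(ξ)|² dξ)^{1/2}`,
valued in `ℝ≥0∞`. -/
noncomputable def sobNorm (σ : ℝ) (f : ℝ → ℂ) : ℝ≥0∞ :=
  (∫⁻ ξ : ℝ, ENNReal.ofReal (jap ξ ^ (2 * σ)) * (‖f ξ‖₊ : ℝ≥0∞) ^ 2) ^ (1 / 2 : ℝ)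

/-- Cubic resonance function of the gauged Benjamin–Ono equation,
with `ξ₃ = ξ - ξ₁ - ξ₂`. -/
noncomputable def Φbo (ξ ξ₁ ξ₂ : ℝ) : ℝ :=
  |ξ| * ξ - |ξ₁| * ξ₁ + |ξ₂| * ξ₂ - |ξ - ξ₁ - ξ₂| * (ξ - ξ₁ - ξ₂)

lemma one_le_jap (x : ℝ) : 1 ≤ jap x :=
  Real.one_le_sqrt.mpr (by nlinarith [sq_nonneg x])

lemma jap_pos (x : ℝ) : 0 < jap x := one_pos.trans_le (one_le_jap x)

lemma abs_le_jap (x : ℝ) : |x| ≤ jap x :=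
  Real.abs_le_sqrt (by linarith)

lemma jap_sq (x : ℝ) : jap x ^ 2 = 1 + x ^ 2 :=
  Real.sq_sqrt (by positivity)

lemma jap_le_two_mul {x : ℝ} (hx : 1 ≤ x) : jap x ≤ 2 * x :=
  Real.sqrt_le_iff.mpr ⟨by linarith, by nlinarith⟩

lemma jap_mono {x y : ℝ} (hx : 0 ≤ x) (hxy : x ≤ y) : jap x ≤ jap y :=
  Real.sqrt_le_sqrt (by nlinarith)

lemma continuous_jap : Continuous jap := by
  unfold jap; fun_prop

lemma continuous_jap_rpow (p : ℝ) : Continuous fun x => jap x ^ p :=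
  continuous_jap.rpow_const fun x => Or.inl (jap_pos x).ne'

/-- The weighted kernel whose `L²` bounds in `(ξ₁, ξ₂)` govern the estimate. -/
noncomputable def cubicKernel (s ε σ ξ ξ₁ ξ₂ : ℝ) : ℝ :=
  jap ξ ^ (s + ε + 1) * (jap (Φbo ξ ξ₁ ξ₂) ^ (-σ) *
    (|ξ₂ + (ξ - ξ₁ - ξ₂)| * |ξ - ξ₁ - ξ₂|)) *
    (jap ξ₁ ^ (-(s + 1)) * jap ξ₂ ^ (-(s + 1)) * jap (ξ - ξ₁ - ξ₂) ^ (-(s + 1)))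

/-- A two-power profile in `d`, normalized so that its integral over `(0, ∞)` does not
depend on `ξ`. -/
noncomputable def twoPower (a b ξ d : ℝ) : ℝ :=
  if d ≤ ξ then (d / ξ) ^ a * ξ ^ (-1 : ℝ) else (d / ξ) ^ (-b) * ξ ^ (-1 : ℝ)

lemma rpow_sq_eq {x : ℝ} (hx : 0 < x) (p : ℝ) : (x ^ p) ^ 2 = x ^ (2 * p) := by
  rw [← Real.rpow_mul_natCast hx.le]; congr 1; push_cast; ring

lemma cubicKernel_sq_le {s ε σ θ ξ ξ₁ ξ₂ : ℝ} (hθs : θ ≤ s) (hξ : 1 < ξ)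
    (h1 : ξ < ξ₁) :
    cubicKernel s ε σ ξ ξ₁ ξ₂ ^ 2 ≤
      jap ξ ^ (2 * ε) * (jap ξ / jap ξ₁) ^ (2 * θ + 2) * jap (Φbo ξ ξ₁ ξ₂) ^ (-(2 * σ)) *
        (ξ₁ - ξ) ^ 2 * (jap ξ₂ * jap (ξ - ξ₁ - ξ₂)) ^ (-(2 * θ)) * (1 + ξ₂ ^ 2)⁻¹ := by
  set z := ξ - ξ₁ - ξ₂ with hz
  have hP := jap_pos (Φbo ξ ξ₁ ξ₂)
  have h0 := jap_pos ξ
  have hj1 := jap_pos ξ₁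
  have hj2 := jap_pos ξ₂
  have hjz := jap_pos z
  have hyz : |ξ₂ + z| = ξ₁ - ξ := by
    rw [hz, show ξ₂ + (ξ - ξ₁ - ξ₂) = -(ξ₁ - ξ) by ring, abs_neg, abs_of_pos (by linarith)]
  have e : cubicKernel s ε σ ξ ξ₁ ξ₂ ^ 2 =
      jap ξ ^ (2 * ε) * (jap ξ / jap ξ₁) ^ (2 * s + 2) * jap (Φbo ξ ξ₁ ξ₂) ^ (-(2 * σ)) *
        (ξ₁ - ξ) ^ 2 * ((jap ξ₂ * jap z) ^ (-(2 * s)) * (jap z ^ 2)⁻¹ * |z| ^ 2) *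
        (1 + ξ₂ ^ 2)⁻¹ := by
    rw [cubicKernel, ← hz, hyz]
    simp only [mul_pow, rpow_sq_eq hP, rpow_sq_eq h0, rpow_sq_eq hj1, rpow_sq_eq hj2,
      rpow_sq_eq hjz, ← jap_sq]
    rw [Real.div_rpow h0.le hj1.le, Real.mul_rpow hj2.le hjz.le, div_eq_mul_inv,
      ← Real.rpow_neg hj1.le, show 2 * (s + ε + 1) = 2 * ε + (2 * s + 2) by ring,
      Real.rpow_add h0, show 2 * -(s + 1) = -(2 * s) + -(2 : ℕ) by push_cast; ring,
      Real.rpow_add hj2, Real.rpow_add hjz, Real.rpow_add hj1, Real.rpow_neg hj2.le (2 : ℕ),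
      Real.rpow_neg hjz.le (2 : ℕ), Real.rpow_natCast, Real.rpow_natCast,
      show -(2 * s + 2) = -(2 * s) + -(2 : ℕ) by push_cast; ring, Real.rpow_add hj1,
      show 2 * -σ = -(2 * σ) by ring]
    ring
  rw [e]
  have hr : jap ξ / jap ξ₁ ≤ 1 :=
    (div_le_one hj1).mpr (jap_mono (by linarith) h1.le)
  have hr' : (jap ξ / jap ξ₁) ^ (2 * s + 2) ≤ (jap ξ / jap ξ₁) ^ (2 * θ + 2) :=
    Real.rpow_le_rpow_of_exponent_ge (by positivity) hr (by linarith)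
  have hm : (jap ξ₂ * jap z) ^ (-(2 * s)) * (jap z ^ 2)⁻¹ * |z| ^ 2 ≤
      (jap ξ₂ * jap z) ^ (-(2 * θ)) := by
    have hz1 : (jap z ^ 2)⁻¹ * |z| ^ 2 ≤ 1 := by
      rw [inv_mul_le_one₀ (by positivity)]
      gcongr; exact abs_le_jap z
    rw [mul_assoc]
    calc _ ≤ (jap ξ₂ * jap z) ^ (-(2 * s)) * 1 := by gcongr
      _ ≤ _ := by
        rw [mul_one]
        exact Real.rpow_le_rpow_of_exponent_le
          (one_le_mul_of_one_le_of_one_le (one_le_jap _) (one_le_jap _)) (by linarith)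
  gcongr

lemma jap_div_jap_le {ξ ξ₁ : ℝ} (hξ : 1 < ξ) (h1 : ξ < ξ₁) :
    jap ξ / jap ξ₁ ≤ 2 * min 1 (ξ / (ξ₁ - ξ)) := by
  have hd : 0 < ξ₁ - ξ := by linarith
  rw [mul_min_of_nonneg _ _ (by norm_num)]
  refine le_min ?_ ?_
  · rw [div_le_iff₀ (jap_pos _)]
    linarith [jap_mono (by linarith) h1.le, jap_pos ξ₁]
  · calc jap ξ / jap ξ₁ ≤ (2 * ξ) / (ξ₁ - ξ) := by
          gcongr
          · exact jap_le_two_mul hξ.le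
          · linarith [le_abs_self ξ₁, abs_le_jap ξ₁]
      _ = _ := by ring

lemma cubicKernel_sq_le_min {s ε σ θ ξ ξ₁ ξ₂ : ℝ} (hε : 0 ≤ ε) (hθ : 0 ≤ θ)
    (hθs : θ ≤ s) (hξ : 1 < ξ) (h1 : ξ < ξ₁) :
    cubicKernel s ε σ ξ ξ₁ ξ₂ ^ 2 ≤ 2 ^ (2 * ε) * 2 ^ (2 * θ + 2) * (ξ ^ (2 * ε) *
      min 1 (ξ / (ξ₁ - ξ)) ^ (2 * θ + 2) * jap (Φbo ξ ξ₁ ξ₂) ^ (-(2 * σ)) * (ξ₁ - ξ) ^ 2 *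
      (jap ξ₂ * jap (ξ - ξ₁ - ξ₂)) ^ (-(2 * θ)) * (1 + ξ₂ ^ 2)⁻¹) := by
  refine (cubicKernel_sq_le hθs hξ h1).trans ?_
  have hd0 : 0 < ξ₁ - ξ := by linarith
  have hξ0 : 0 < ξ := by linarith
  have hmin : 0 < min 1 (ξ / (ξ₁ - ξ)) := by positivity
  have b1 : jap ξ ^ (2 * ε) ≤ (2 * ξ) ^ (2 * ε) :=
    Real.rpow_le_rpow (jap_pos _).le (jap_le_two_mul hξ.le) (by linarith)
  have b2 : (jap ξ / jap ξ₁) ^ (2 * θ + 2) ≤ (2 * min 1 (ξ / (ξ₁ - ξ))) ^ (2 * θ + 2) :=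
    Real.rpow_le_rpow (div_pos (jap_pos _) (jap_pos _)).le (jap_div_jap_le hξ h1)
      (by linarith)
  rw [Real.mul_rpow two_pos.le hξ0.le] at b1
  rw [Real.mul_rpow two_pos.le hmin.le] at b2
  have := jap_pos ξ; have := jap_pos ξ₁; have := jap_pos ξ₂
  have := jap_pos (ξ - ξ₁ - ξ₂); have := jap_pos (Φbo ξ ξ₁ ξ₂)
  calc _ ≤ 2 ^ (2 * ε) * ξ ^ (2 * ε) *
        (2 ^ (2 * θ + 2) * min 1 (ξ / (ξ₁ - ξ)) ^ (2 * θ + 2)) *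
        jap (Φbo ξ ξ₁ ξ₂) ^ (-(2 * σ)) * (ξ₁ - ξ) ^ 2 *
        (jap ξ₂ * jap (ξ - ξ₁ - ξ₂)) ^ (-(2 * θ)) * (1 + ξ₂ ^ 2)⁻¹ := by gcongr
    _ = _ := by ring

/-- Away from the resonant set the phase is at least `(ξ₁ - ξ) ξ`. -/
lemma cubicKernel_sq_le_of_le_phase {s ε σ θ ξ ξ₁ ξ₂ : ℝ} (hε : 0 ≤ ε) (hθ : 0 ≤ θ)
    (hθs : θ ≤ s) (hσ : 0 ≤ σ) (h : 2 * ε + 3 - 4 * σ - 2 * θ ≤ 0) (hξ : 1 < ξ) (h1 : ξ < ξ₁)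
    (hΦ : (ξ₁ - ξ) * ξ ≤ |Φbo ξ ξ₁ ξ₂|) :
    cubicKernel s ε σ ξ ξ₁ ξ₂ ^ 2 ≤ 2 ^ (2 * ε) * 2 ^ (2 * θ + 2) * (2 ^ (2 * θ) *
      (twoPower (2 - 2 * θ - 2 * σ) (4 * θ + 2 * σ) ξ (ξ₁ - ξ) * (1 + ξ₂ ^ 2)⁻¹)) := by
  refine (cubicKernel_sq_le_min hε hθ hθs hξ h1).trans ?_
  set d := ξ₁ - ξ with hd
  have hd0 : 0 < d := by linarith
  have hξ0 : 0 < ξ := by linarith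
  have b3 : jap (Φbo ξ ξ₁ ξ₂) ^ (-(2 * σ)) ≤ (d * ξ) ^ (-(2 * σ)) :=
    Real.rpow_le_rpow_of_nonpos (by positivity) (hΦ.trans (abs_le_jap _)) (by linarith)
  have b4 : (jap ξ₂ * jap (ξ - ξ₁ - ξ₂)) ^ (-(2 * θ)) ≤ 2 ^ (2 * θ) * d ^ (-(2 * θ)) := by
    have : (jap ξ₂ * jap (ξ - ξ₁ - ξ₂)) ^ (-(2 * θ)) ≤ (d / 2) ^ (-(2 * θ)) := by
      refine Real.rpow_le_rpow_of_nonpos (by positivity) ?_ (by linarith)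
      have e1 := one_le_jap ξ₂
      have e2 := one_le_jap (ξ - ξ₁ - ξ₂)
      have e3 := (neg_abs_le ξ₂).trans' (neg_le_neg (abs_le_jap ξ₂))
      have e4 := (neg_abs_le (ξ - ξ₁ - ξ₂)).trans' (neg_le_neg (abs_le_jap (ξ - ξ₁ - ξ₂)))
      nlinarith
    rwa [Real.div_rpow hd0.le two_pos.le, Real.rpow_neg two_pos.le, div_inv_eq_mul,
      mul_comm (_ ^ (-(2 * θ)))] at this
  have key : ξ ^ (2 * ε) * min 1 (ξ / d) ^ (2 * θ + 2) * (d * ξ) ^ (-(2 * σ)) * d ^ 2 *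
      d ^ (-(2 * θ)) ≤ twoPower (2 - 2 * θ - 2 * σ) (4 * θ + 2 * σ) ξ d := by
    have hle : ξ ^ (2 * ε + 3 - 4 * σ - 2 * θ) ≤ 1 :=
      Real.rpow_le_one_of_one_le_of_nonpos hξ.le h
    unfold twoPower
    rw [← Real.rpow_natCast d 2]
    split_ifs with hc
    · rw [min_eq_left ((one_le_div hd0).mpr hc), Real.one_rpow]
      refine le_of_eq_of_le ?_ (mul_le_of_le_one_right (by positivity) hle)
      simp only [Real.rpow_def_of_pos, hd0, hξ0, div_pos, mul_pos, Real.log_mul, mul_one,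
        Real.log_div, hd0.ne', hξ0.ne', ne_eq, not_false_eq_true, ← Real.exp_add]
      congr 1; push_cast; ring
    · rw [min_eq_right ((div_le_one hd0).mpr (not_le.mp hc).le)]
      refine le_of_eq_of_le ?_ (mul_le_of_le_one_right (by positivity) hle)
      simp only [Real.rpow_def_of_pos, hd0, hξ0, div_pos, mul_pos, Real.log_mul,
        Real.log_div, hd0.ne', hξ0.ne', ne_eq, not_false_eq_true, ← Real.exp_add]
      congr 1; push_cast; ring
  have := jap_pos ξ₂; have := jap_pos (ξ - ξ₁ - ξ₂); have := jap_pos (Φbo ξ ξ₁ ξ₂)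
  refine mul_le_mul_of_nonneg_left ?_ (by positivity)
  calc _ ≤ ξ ^ (2 * ε) * min 1 (ξ / d) ^ (2 * θ + 2) * (d * ξ) ^ (-(2 * σ)) * d ^ 2 *
        (2 ^ (2 * θ) * d ^ (-(2 * θ))) * (1 + ξ₂ ^ 2)⁻¹ := by gcongr
    _ = 2 ^ (2 * θ) * ((ξ ^ (2 * ε) * min 1 (ξ / d) ^ (2 * θ + 2) * (d * ξ) ^ (-(2 * σ)) *
        d ^ 2 * d ^ (-(2 * θ))) * (1 + ξ₂ ^ 2)⁻¹) := by ring
    _ ≤ _ := by gcongr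

lemma Φbo_eq_of_nonneg {ξ ξ₁ ξ₂ : ℝ} (hξ : 1 < ξ) (h1 : ξ < ξ₁) (h2 : 0 ≤ ξ₂) :
    Φbo ξ ξ₁ ξ₂ = 2 * (ξ₂ ^ 2 + (ξ₁ - ξ) * ξ₂ - (ξ₁ - ξ) * ξ) := by
  rw [Φbo, abs_of_pos (by linarith), abs_of_pos (by linarith), abs_of_nonneg h2,
    abs_of_neg (by linarith)]
  ring

lemma pos_of_abs_phase_lt {ξ ξ₁ ξ₂ : ℝ} (hξ : 1 < ξ) (h1 : ξ < ξ₁)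
    (hΦ : |Φbo ξ ξ₁ ξ₂| < (ξ₁ - ξ) * ξ) : 0 < ξ₂ := by
  by_contra! h2
  have hd : 0 < (ξ₁ - ξ) * ξ := mul_pos (by linarith) (by linarith)
  have hlow := neg_abs_le (Φbo ξ ξ₁ ξ₂)
  have hbad : Φbo ξ ξ₁ ξ₂ ≤ -((ξ₁ - ξ) * ξ) := by
    rw [Φbo, abs_of_pos (by linarith), abs_of_pos (by linarith), abs_of_nonpos h2]
    rcases le_total (ξ - ξ₁ - ξ₂) 0 with h3 | h3
    · rw [abs_of_nonpos h3]; nlinarith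
    · rw [abs_of_nonneg h3]; nlinarith [sq_nonneg ξ₂, sq_nonneg (ξ - ξ₁ - ξ₂)]
  linarith

/-- On the resonant set the second frequency is positive, and the phase is a quadratic
polynomial in it whose derivative is `2 (2 ξ₂ + ξ₁ - ξ)`. -/
lemma cubicKernel_sq_le_of_phase_lt {s ε σ θ ξ ξ₁ ξ₂ : ℝ} (hε : 0 ≤ ε) (hθ : 0 ≤ θ)
    (hθs : θ ≤ s) (hεθ : ε ≤ 2 * θ) (hξ : 1 < ξ) (h1 : ξ < ξ₁)
    (hΦ : |Φbo ξ ξ₁ ξ₂| < (ξ₁ - ξ) * ξ) :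
    cubicKernel s ε σ ξ ξ₁ ξ₂ ^ 2 ≤ 2 ^ (2 * ε) * 2 ^ (2 * θ + 2) * (32 * 2 ^ (2 * θ) *
      (twoPower (1 / 2 - 2 * θ) (1 + 4 * θ) ξ (ξ₁ - ξ) * ((2 * ξ₂ + (ξ₁ - ξ)) *
        jap (2 * (ξ₂ ^ 2 + (ξ₁ - ξ) * ξ₂ - (ξ₁ - ξ) * ξ)) ^ (-(2 * σ))))) := by
  refine (cubicKernel_sq_le_min hε hθ hθs hξ h1).trans ?_
  have hy := pos_of_abs_phase_lt hξ h1 hΦ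
  rw [Φbo_eq_of_nonneg hξ h1 hy.le] at hΦ ⊢
  have hz : ξ₂ + (ξ₁ - ξ) ≤ jap (ξ - ξ₁ - ξ₂) := by
    linarith [neg_abs_le (ξ - ξ₁ - ξ₂), abs_le_jap (ξ - ξ₁ - ξ₂)]
  set d := ξ₁ - ξ with hd
  have hd0 : 0 < d := by linarith
  have hξ0 : 0 < ξ := by linarith
  have hlow : d * ξ / 2 ≤ ξ₂ * (ξ₂ + d) := by nlinarith [(abs_lt.mp hΦ).1]
  set J := jap (2 * (ξ₂ ^ 2 + d * ξ₂ - d * ξ)) ^ (-(2 * σ)) with hJ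
  have hJ0 : 0 < J := Real.rpow_pos_of_pos (jap_pos _) _
  have b4 : (jap ξ₂ * jap (ξ - ξ₁ - ξ₂)) ^ (-(2 * θ)) ≤
      2 ^ (2 * θ) * (d * ξ) ^ (-(2 * θ)) := by
    have : (jap ξ₂ * jap (ξ - ξ₁ - ξ₂)) ^ (-(2 * θ)) ≤ (d * ξ / 2) ^ (-(2 * θ)) := by
      refine Real.rpow_le_rpow_of_nonpos (by positivity) (hlow.trans ?_) (by linarith)
      have := (le_abs_self ξ₂).trans (abs_le_jap ξ₂)
      have := jap_pos ξ₂
      gcongr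
    rwa [Real.div_rpow (by positivity) two_pos.le, Real.rpow_neg two_pos.le, div_inv_eq_mul,
      mul_comm (_ ^ (-(2 * θ)))] at this
  have hle : ξ ^ (2 * ε - 4 * θ) ≤ 1 :=
    Real.rpow_le_one_of_one_le_of_nonpos hξ.le (by linarith)
  have key : ξ ^ (2 * ε) * min 1 (ξ / d) ^ (2 * θ + 2) * d ^ 2 * (d * ξ) ^ (-(2 * θ)) *
      (1 + ξ₂ ^ 2)⁻¹ ≤
      32 * (twoPower (1 / 2 - 2 * θ) (1 + 4 * θ) ξ d * (2 * ξ₂ + d)) := by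
    unfold twoPower
    rw [← Real.rpow_natCast d 2]
    rcases le_or_gt d ξ with hc | hc
    · rw [if_pos hc, min_eq_left ((one_le_div hd0).mpr hc), Real.one_rpow]
      have hy2 : d * ξ / 16 ≤ ξ₂ ^ 2 := by
        rcases le_total d ξ₂ with h | h
        · nlinarith
        · have : ξ / 4 ≤ ξ₂ := by
            by_contra! hlt
            nlinarith
          nlinarith
      have hinv : (1 + ξ₂ ^ 2)⁻¹ ≤ 16 * (d * ξ) ^ (-1 : ℝ) := by
        rw [Real.rpow_neg_one, show 16 * (d * ξ)⁻¹ = (d * ξ / 16)⁻¹ by field_simp]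
        gcongr; linarith
      have hone : 1 ≤ 2 * (d * ξ) ^ (-(1 / 2) : ℝ) * (2 * ξ₂ + d) := by
        rw [Real.rpow_neg (by positivity), ← Real.sqrt_eq_rpow]
        have : √(d * ξ) ≤ 4 * ξ₂ := Real.sqrt_le_iff.mpr ⟨by linarith, by nlinarith⟩
        have : 0 < √(d * ξ) := by positivity
        field_simp
        linarith
      calc _ ≤ ξ ^ (2 * ε) * 1 * d ^ ((2 : ℕ) : ℝ) * (d * ξ) ^ (-(2 * θ)) *
            (16 * (d * ξ) ^ (-1 : ℝ)) * (2 * (d * ξ) ^ (-(1 / 2) : ℝ) * (2 * ξ₂ + d)) := by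
            rw [← mul_one (_ * (1 + ξ₂ ^ 2)⁻¹)]
            gcongr
        _ = 32 * ((d / ξ) ^ (1 / 2 - 2 * θ) * ξ ^ (-1 : ℝ) * ξ ^ (2 * ε - 4 * θ) *
            (2 * ξ₂ + d)) := by
            have : ξ ^ (2 * ε) * d ^ ((2 : ℕ) : ℝ) * (d * ξ) ^ (-(2 * θ)) *
              (d * ξ) ^ (-1 : ℝ) * (d * ξ) ^ (-(1 / 2) : ℝ) =
              (d / ξ) ^ (1 / 2 - 2 * θ) * ξ ^ (-1 : ℝ) * ξ ^ (2 * ε - 4 * θ) := by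
              simp only [Real.rpow_def_of_pos, hd0, hξ0, div_pos, mul_pos, Real.log_mul,
                Real.log_div, hd0.ne', hξ0.ne', ne_eq, not_false_eq_true, ← Real.exp_add]
              congr 1; push_cast; ring
            rw [← this]; ring
        _ ≤ _ := by
            refine mul_le_mul_of_nonneg_left (mul_le_mul_of_nonneg_right
              (mul_le_of_le_one_right (by positivity) hle) (by positivity)) (by norm_num)
    · rw [if_neg hc.not_ge, min_eq_right ((div_le_one hd0).mpr hc.le)]
      have hy2 : ξ / 4 ≤ ξ₂ := by
        by_contra! hlt
        nlinarith
      have hinv : (1 + ξ₂ ^ 2)⁻¹ ≤ 16 * ξ ^ (-2 : ℝ) := by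
        rw [Real.rpow_neg hξ0.le, Real.rpow_two,
          show 16 * (ξ ^ 2)⁻¹ = ((ξ / 4) ^ 2)⁻¹ by field_simp; norm_num]
        gcongr; nlinarith
      have hone : 1 ≤ 2 * d ^ (-1 : ℝ) * (2 * ξ₂ + d) := by
        rw [Real.rpow_neg_one]
        field_simp
        linarith
      calc _ ≤ ξ ^ (2 * ε) * (ξ / d) ^ (2 * θ + 2) * d ^ ((2 : ℕ) : ℝ) *
            (d * ξ) ^ (-(2 * θ)) *
            (16 * ξ ^ (-2 : ℝ)) * (2 * d ^ (-1 : ℝ) * (2 * ξ₂ + d)) := by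
            rw [← mul_one (_ * (1 + ξ₂ ^ 2)⁻¹)]
            gcongr
        _ = 32 * ((d / ξ) ^ (-(1 + 4 * θ)) * ξ ^ (-1 : ℝ) * ξ ^ (2 * ε - 4 * θ) *
            (2 * ξ₂ + d)) := by
            have : ξ ^ (2 * ε) * (ξ / d) ^ (2 * θ + 2) * d ^ ((2 : ℕ) : ℝ) *
              (d * ξ) ^ (-(2 * θ)) * ξ ^ (-2 : ℝ) * d ^ (-1 : ℝ) =
              (d / ξ) ^ (-(1 + 4 * θ)) * ξ ^ (-1 : ℝ) * ξ ^ (2 * ε - 4 * θ) := by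
              simp only [Real.rpow_def_of_pos, hd0, hξ0, div_pos, mul_pos, Real.log_mul,
                Real.log_div, hd0.ne', hξ0.ne', ne_eq, not_false_eq_true, ← Real.exp_add]
              congr 1; push_cast; ring
            rw [← this]; ring
        _ ≤ _ := by
            refine mul_le_mul_of_nonneg_left (mul_le_mul_of_nonneg_right
              (mul_le_of_le_one_right (by positivity) hle) (by positivity)) (by norm_num)
  have hmin : 0 < min 1 (ξ / d) := by positivity
  refine mul_le_mul_of_nonneg_left ?_ (by positivity)
  calc _ ≤ ξ ^ (2 * ε) * min 1 (ξ / d) ^ (2 * θ + 2) * J * d ^ 2 *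
        (2 ^ (2 * θ) * (d * ξ) ^ (-(2 * θ))) * (1 + ξ₂ ^ 2)⁻¹ := by gcongr
    _ = 2 ^ (2 * θ) * (ξ ^ (2 * ε) * min 1 (ξ / d) ^ (2 * θ + 2) * d ^ 2 *
        (d * ξ) ^ (-(2 * θ)) * (1 + ξ₂ ^ 2)⁻¹) * J := by ring
    _ ≤ 2 ^ (2 * θ) * (32 * (twoPower (1 / 2 - 2 * θ) (1 + 4 * θ) ξ d * (2 * ξ₂ + d))) *
        J := by gcongr
    _ = _ := by ring

lemma twoPower_nonneg {a b ξ d : ℝ} (hξ : 0 < ξ) (hd : 0 < d) : 0 ≤ twoPower a b ξ d := by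
  unfold twoPower; positivity

lemma measurable_twoPower (a b ξ : ℝ) : Measurable (twoPower a b ξ) := by
  unfold twoPower
  exact Measurable.ite measurableSet_Iic (by fun_prop) (by fun_prop)

lemma lintegral_Ioc_rpow_le {a ξ : ℝ} (ha : -1 < a) (hξ : 0 < ξ) :
    ∫⁻ d in Set.Ioc 0 ξ, ENNReal.ofReal ((d / ξ) ^ a * ξ ^ (-1 : ℝ)) ≤
      ENNReal.ofReal (1 / (a + 1)) := by
  have hi := (intervalIntegral.intervalIntegrable_rpow' (a := 0) (b := ξ) ha).1
  have hcongr : ∀ d ∈ Set.Ioc 0 ξ, ENNReal.ofReal ((d / ξ) ^ a * ξ ^ (-1 : ℝ)) =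
      ENNReal.ofReal (ξ ^ (-a - 1)) * ENNReal.ofReal (d ^ a) := fun d hd => by
    rw [← ENNReal.ofReal_mul (by positivity), Real.div_rpow hd.1.le hξ.le,
      show -a - 1 = -a + -1 by ring, Real.rpow_add hξ, Real.rpow_neg hξ.le a]
    congr 1; ring
  rw [setLIntegral_congr_fun measurableSet_Ioc hcongr, lintegral_const_mul _ (by fun_prop),
    ← ofReal_integral_eq_lintegral_ofReal hi
      ((ae_restrict_mem measurableSet_Ioc).mono fun d hd => Real.rpow_nonneg hd.1.le _),
    ← intervalIntegral.integral_of_le hξ.le, integral_rpow (Or.inl ha),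
    Real.zero_rpow (by linarith), ← ENNReal.ofReal_mul (by positivity)]
  refine ENNReal.ofReal_le_ofReal (le_of_eq ?_)
  rw [sub_zero, mul_div_assoc', ← Real.rpow_add hξ, show -a - 1 + (a + 1) = 0 by ring,
    Real.rpow_zero]

lemma lintegral_Ioi_rpow_le {b ξ : ℝ} (hb : 1 < b) (hξ : 0 < ξ) :
    ∫⁻ d in Set.Ioi ξ, ENNReal.ofReal ((d / ξ) ^ (-b) * ξ ^ (-1 : ℝ)) ≤
      ENNReal.ofReal (1 / (b - 1)) := by
  have hi := integrableOn_Ioi_rpow_of_lt (neg_lt_neg hb) hξ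
  have hcongr : ∀ d ∈ Set.Ioi ξ, ENNReal.ofReal ((d / ξ) ^ (-b) * ξ ^ (-1 : ℝ)) =
      ENNReal.ofReal (ξ ^ (b - 1)) * ENNReal.ofReal (d ^ (-b)) := fun d hd => by
    rw [← ENNReal.ofReal_mul (by positivity), Real.div_rpow (hξ.trans hd).le hξ.le,
      show b - 1 = b + -1 by ring, Real.rpow_add hξ, Real.rpow_neg hξ.le b, div_inv_eq_mul]
    congr 1; ring
  rw [setLIntegral_congr_fun measurableSet_Ioi hcongr, lintegral_const_mul _ (by fun_prop),
    ← ofReal_integral_eq_lintegral_ofReal hi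
      ((ae_restrict_mem measurableSet_Ioi).mono fun d hd =>
        Real.rpow_nonneg (hξ.trans hd).le _),
    integral_Ioi_rpow_of_lt (neg_lt_neg hb) hξ, ← ENNReal.ofReal_mul (by positivity)]
  refine ENNReal.ofReal_le_ofReal (le_of_eq ?_)
  rw [mul_div_assoc', mul_neg, ← Real.rpow_add hξ, show b - 1 + (-b + 1) = 0 by ring,
    Real.rpow_zero, show -b + 1 = -(b - 1) by ring, neg_div_neg_eq]

lemma lintegral_twoPower_le {a b ξ : ℝ} (ha : -1 < a) (hb : 1 < b) (hξ : 0 < ξ) :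
    ∫⁻ d in Set.Ioi 0, ENNReal.ofReal (twoPower a b ξ d) ≤
      ENNReal.ofReal (1 / (a + 1)) + ENNReal.ofReal (1 / (b - 1)) := by
  rw [← Set.Ioc_union_Ioi_eq_Ioi hξ.le]
  refine (lintegral_union_le _ _ _).trans (add_le_add ?_ ?_)
  · refine le_of_eq_of_le (setLIntegral_congr_fun measurableSet_Ioc fun d hd => ?_)
      (lintegral_Ioc_rpow_le ha hξ)
    simp only [twoPower, if_pos hd.2]
  · refine le_of_eq_of_le (setLIntegral_congr_fun measurableSet_Ioi fun d hd => ?_)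
      (lintegral_Ioi_rpow_le hb hξ)
    simp only [twoPower, if_neg (not_le.mpr (Set.mem_Ioi.mp hd))]

/-- Translated form of `lintegral_twoPower_le`. -/
lemma lintegral_twoPower_sub_le {a b ξ : ℝ} (ha : -1 < a) (hb : 1 < b) (hξ : 0 < ξ) :
    ∫⁻ ξ₁ in Set.Ioi ξ, ENNReal.ofReal (twoPower a b ξ (ξ₁ - ξ)) ≤
      ENNReal.ofReal (1 / (a + 1)) + ENNReal.ofReal (1 / (b - 1)) := by
  refine le_of_eq_of_le ?_ (lintegral_twoPower_le ha hb hξ)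
  rw [← lintegral_indicator measurableSet_Ioi, ← lintegral_indicator measurableSet_Ioi,
    ← lintegral_sub_right_eq_self (Set.indicator (Set.Ioi 0) _) ξ]
  refine lintegral_congr fun x => ?_
  simp only [Set.indicator, Set.mem_Ioi, sub_pos]

lemma lintegral_quadratic_le {d : ℝ} (hd : 0 ≤ d) (c : ℝ) (G : ℝ → ℝ≥0∞) :
    ∫⁻ y in Set.Ioi 0, ENNReal.ofReal (2 * y + d) * G (2 * (y ^ 2 + d * y - c)) ≤
      ∫⁻ u, G u := by
  have hder : ∀ y ∈ Set.Ioi (0 : ℝ), HasDerivWithinAt (fun y => 2 * (y ^ 2 + d * y - c))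
      (2 * (2 * y + d)) (Set.Ioi 0) y := fun y _ => by
    have := ((((hasDerivAt_id y).pow 2).add ((hasDerivAt_id y).const_mul d)).sub_const
      c).const_mul 2
    refine HasDerivAt.hasDerivWithinAt (this.congr_deriv ?_)
    simp
  have hinj : Set.InjOn (fun y => 2 * (y ^ 2 + d * y - c)) (Set.Ioi 0) := by
    intro x hx y hy hxy
    simp only [Set.mem_Ioi] at hx hy hxy
    have : (x - y) * (x + y + d) = 0 := by linarith
    rcases mul_eq_zero.mp this with h | h <;> linarith
  calc _ ≤ ∫⁻ y in Set.Ioi 0, ENNReal.ofReal |2 * (2 * y + d)| *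
        G (2 * (y ^ 2 + d * y - c)) := by
        refine setLIntegral_mono' measurableSet_Ioi fun y hy => ?_
        have : (0 : ℝ) < y := hy
        gcongr
        exact (by linarith : 2 * y + d ≤ 2 * (2 * y + d)).trans (le_abs_self _)
    _ = ∫⁻ u in (fun y => 2 * (y ^ 2 + d * y - c)) '' Set.Ioi 0, G u :=
        (lintegral_image_eq_lintegral_abs_deriv_mul measurableSet_Ioi hder hinj G).symm
    _ ≤ _ := setLIntegral_le_lintegral _ _

lemma lintegral_jap_rpow_lt_top {p : ℝ} (hp : 1 < p) :
    ∫⁻ u, ENNReal.ofReal (jap u ^ (-p)) < ⊤ := by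
  have h : Integrable (fun x : ℝ => (1 + ‖x‖ ^ 2) ^ (-p / 2)) :=
    integrable_rpow_neg_one_add_norm_sq (by simpa using hp)
  refine lt_of_eq_of_lt (lintegral_congr fun x => ?_) h.lintegral_lt_top
  rw [jap, Real.sqrt_eq_rpow, ← Real.rpow_mul (by positivity), Real.norm_eq_abs, sq_abs]
  congr 2; ring

/-- Uniform `L²` bound for the kernel in `(ξ₁, ξ₂)`. The exponents `θ` and `η` govern the
nonresonant and resonant regions respectively. -/
lemma exists_lintegral_cubicKernel_sq_le {s ε σ θ η : ℝ} (hε : 0 ≤ ε) (hσ : 1 < 2 * σ)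
    (hθ : 0 ≤ θ) (hθs : θ ≤ s) (hθσ : 2 * ε + 3 - 4 * σ - 2 * θ ≤ 0)
    (hθσ' : 2 * θ + 2 * σ < 3) (hη : 0 < η) (hηs : η ≤ s) (hεη : ε ≤ 2 * η)
    (hη' : η < 3 / 4) :
    ∃ C : ℝ≥0∞, C ≠ ⊤ ∧ ∀ ξ : ℝ, 1 < ξ →
      ∫⁻ ξ₁ in Set.Ioi ξ, ∫⁻ ξ₂, ENNReal.ofReal (cubicKernel s ε σ ξ ξ₁ ξ₂ ^ 2) ≤ C := by
  set A := ENNReal.ofReal (2 ^ (2 * ε) * 2 ^ (2 * θ + 2) * 2 ^ (2 * θ)) with hA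
  set B := ENNReal.ofReal (2 ^ (2 * ε) * 2 ^ (2 * η + 2) * (32 * 2 ^ (2 * η))) with hB
  set I := ∫⁻ y : ℝ, ENNReal.ofReal (1 + y ^ 2)⁻¹ with hI
  set J := ∫⁻ u, ENNReal.ofReal (jap u ^ (-(2 * σ))) with hJ
  set a := fun ξ ξ₁ => twoPower (2 - 2 * θ - 2 * σ) (4 * θ + 2 * σ) ξ (ξ₁ - ξ) with ha
  set b := fun ξ ξ₁ => twoPower (1 / 2 - 2 * η) (1 + 4 * η) ξ (ξ₁ - ξ) with hb
  have hIt : I ≠ ⊤ := integrable_inv_one_add_sq.lintegral_lt_top.ne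
  have hJt : J ≠ ⊤ := (lintegral_jap_rpow_lt_top hσ).ne
  refine ⟨A * I * (ENNReal.ofReal (1 / (2 - 2 * θ - 2 * σ + 1)) +
    ENNReal.ofReal (1 / (4 * θ + 2 * σ - 1))) + B * J *
    (ENNReal.ofReal (1 / (1 / 2 - 2 * η + 1)) + ENNReal.ofReal (1 / (1 + 4 * η - 1))),
    ?_, fun ξ hξ => ?_⟩
  · finiteness
  have hξ0 : 0 < ξ := by linarith
  have pointwise : ∀ ξ₁ ∈ Set.Ioi ξ, ∀ ξ₂, ENNReal.ofReal (cubicKernel s ε σ ξ ξ₁ ξ₂ ^ 2) ≤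
      A * ENNReal.ofReal (a ξ ξ₁) * ENNReal.ofReal (1 + ξ₂ ^ 2)⁻¹ +
      B * ENNReal.ofReal (b ξ ξ₁) * (Set.Ioi 0).indicator (fun y =>
        ENNReal.ofReal (2 * y + (ξ₁ - ξ)) * ENNReal.ofReal
          (jap (2 * (y ^ 2 + (ξ₁ - ξ) * y - (ξ₁ - ξ) * ξ)) ^ (-(2 * σ)))) ξ₂ := by
    intro ξ₁ h1 ξ₂
    have hd : 0 < ξ₁ - ξ := sub_pos.mpr h1
    have ha0 : 0 ≤ a ξ ξ₁ := twoPower_nonneg hξ0 hd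
    have hb0 : 0 ≤ b ξ ξ₁ := twoPower_nonneg hξ0 hd
    rcases le_or_gt ((ξ₁ - ξ) * ξ) |Φbo ξ ξ₁ ξ₂| with hΦ | hΦ
    · refine le_add_right ?_
      rw [← ENNReal.ofReal_mul (by positivity), ← ENNReal.ofReal_mul (by positivity)]
      refine ENNReal.ofReal_le_ofReal ((cubicKernel_sq_le_of_le_phase hε hθ hθs
        (by linarith) hθσ hξ h1 hΦ).trans_eq ?_)
      ring
    · refine le_add_left ?_
      have hy := pos_of_abs_phase_lt hξ h1 hΦ
      rw [Set.indicator_of_mem (Set.mem_Ioi.mpr hy), ← ENNReal.ofReal_mul (by positivity),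
        ← ENNReal.ofReal_mul (by positivity), ← ENNReal.ofReal_mul (by positivity)]
      refine ENNReal.ofReal_le_ofReal ((cubicKernel_sq_le_of_phase_lt hε hη.le hηs
        hεη hξ h1 hΦ).trans_eq ?_)
      ring
  have inner : ∀ ξ₁ ∈ Set.Ioi ξ, ∫⁻ ξ₂, ENNReal.ofReal (cubicKernel s ε σ ξ ξ₁ ξ₂ ^ 2) ≤
      A * I * ENNReal.ofReal (a ξ ξ₁) + B * J * ENNReal.ofReal (b ξ ξ₁) := by
    intro ξ₁ h1
    refine (lintegral_mono (pointwise ξ₁ h1)).trans ?_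
    rw [lintegral_add_left (by fun_prop), lintegral_const_mul _ (by fun_prop),
      lintegral_const_mul' _ _ (by finiteness), lintegral_indicator measurableSet_Ioi,
      mul_right_comm A, mul_right_comm B]
    gcongr
    exact lintegral_quadratic_le (sub_pos.mpr h1).le ((ξ₁ - ξ) * ξ)
      fun u => ENNReal.ofReal (jap u ^ (-(2 * σ)))
  have hma : Measurable fun ξ₁ => ENNReal.ofReal (a ξ ξ₁) :=
    ((measurable_twoPower _ _ ξ).comp (measurable_id.sub_const ξ)).ennreal_ofReal
  have hmb : Measurable fun ξ₁ => ENNReal.ofReal (b ξ ξ₁) :=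
    ((measurable_twoPower _ _ ξ).comp (measurable_id.sub_const ξ)).ennreal_ofReal
  calc _ ≤ ∫⁻ ξ₁ in Set.Ioi ξ, (A * I * ENNReal.ofReal (a ξ ξ₁) +
        B * J * ENNReal.ofReal (b ξ ξ₁)) := setLIntegral_mono' measurableSet_Ioi inner
    _ = A * I * (∫⁻ ξ₁ in Set.Ioi ξ, ENNReal.ofReal (a ξ ξ₁)) +
        B * J * ∫⁻ ξ₁ in Set.Ioi ξ, ENNReal.ofReal (b ξ ξ₁) := by
        rw [lintegral_add_left (hma.const_mul _), lintegral_const_mul _ hma,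
          lintegral_const_mul _ hmb]
    _ ≤ _ := by
        gcongr
        · exact lintegral_twoPower_sub_le (by linarith) (by linarith) hξ0
        · exact lintegral_twoPower_sub_le (by linarith) (by linarith) hξ0

lemma sq_lintegral_lintegral_mul_le {U V : ℝ → ℝ → ℝ≥0∞}
    (hU : Measurable (Function.uncurry U)) (hV : Measurable (Function.uncurry V)) :
    (∫⁻ x, ∫⁻ y, U x y * V x y) ^ 2 ≤
      (∫⁻ x, ∫⁻ y, U x y ^ 2) * ∫⁻ x, ∫⁻ y, V x y ^ 2 := by
  have h := ENNReal.lintegral_mul_le_Lp_mul_Lq ((volume : Measure ℝ).prod volume)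
    Real.HolderConjugate.two_two hU.aemeasurable hV.aemeasurable
  rw [lintegral_prod _ (hU.mul hV).aemeasurable,
    lintegral_prod _ (hU.pow_const _).aemeasurable,
    lintegral_prod _ (hV.pow_const _).aemeasurable] at h
  simp only [Pi.mul_apply, Function.uncurry_apply_pair, ENNReal.rpow_two] at h
  refine (pow_le_pow_left' h 2).trans_eq ?_
  rw [mul_pow, ← ENNReal.rpow_two, ← ENNReal.rpow_two, ← ENNReal.rpow_mul,
    ← ENNReal.rpow_mul]
  norm_num

lemma lintegral_convolution_triple {F₁ F₂ F₃ : ℝ → ℝ≥0∞} (h₁ : Measurable F₁)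
    (h₂ : Measurable F₂) (h₃ : Measurable F₃) :
    ∫⁻ ξ, ∫⁻ ξ₁, ∫⁻ ξ₂, F₁ ξ₁ * F₂ ξ₂ * F₃ (ξ - ξ₁ - ξ₂) =
      (∫⁻ x, F₁ x) * (∫⁻ x, F₂ x) * ∫⁻ x, F₃ x := by
  have inner : ∀ ξ₁ ξ₂, ∫⁻ ξ, F₁ ξ₁ * F₂ ξ₂ * F₃ (ξ - ξ₁ - ξ₂) =
      F₁ ξ₁ * F₂ ξ₂ * ∫⁻ x, F₃ x := fun ξ₁ ξ₂ => by
    rw [lintegral_const_mul _ (by fun_prop)]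
    simp only [sub_sub]
    rw [lintegral_sub_right_eq_self]
  rw [lintegral_lintegral_swap (by
    refine (Measurable.lintegral_prod_right' (f := fun p : (ℝ × ℝ) × ℝ =>
      F₁ p.1.2 * F₂ p.2 * F₃ (p.1.1 - p.1.2 - p.2)) (by fun_prop)).aemeasurable)]
  have : ∀ ξ₁, ∫⁻ ξ, ∫⁻ ξ₂, F₁ ξ₁ * F₂ ξ₂ * F₃ (ξ - ξ₁ - ξ₂) =
      F₁ ξ₁ * ((∫⁻ x, F₂ x) * ∫⁻ x, F₃ x) := fun ξ₁ => by
    rw [lintegral_lintegral_swap (by fun_prop)]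
    simp only [inner]
    simp only [mul_assoc]
    rw [lintegral_const_mul _ (by fun_prop), lintegral_mul_const _ h₂]
  simp only [this]
  rw [lintegral_mul_const _ h₁, mul_assoc]

lemma sobNorm_sq (σ : ℝ) (f : ℝ → ℂ) :
    sobNorm σ f ^ 2 = ∫⁻ ξ, (ENNReal.ofReal (jap ξ ^ σ) * ‖f ξ‖ₑ) ^ 2 := by
  rw [sobNorm, ← ENNReal.rpow_two, ← ENNReal.rpow_mul]
  norm_num
  refine lintegral_congr fun ξ => ?_
  rw [mul_pow, ← ENNReal.ofReal_pow (Real.rpow_nonneg (jap_pos ξ).le _),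
    rpow_sq_eq (jap_pos ξ)]
  rfl

lemma measurable_Φbo (ξ : ℝ) : Measurable fun p : ℝ × ℝ => Φbo ξ p.1 p.2 := by
  unfold Φbo; fun_prop

lemma measurable_cubicKernel (s ε σ ξ : ℝ) :
    Measurable fun p : ℝ × ℝ => cubicKernel s ε σ ξ p.1 p.2 := by
  unfold cubicKernel
  have := measurable_Φbo ξ
  have hj := continuous_jap.measurable
  fun_prop

/-- Each value of the phase-weighted operator is controlled by Cauchy–Schwarz. -/
lemma enorm_phaseWeighted_le {s ε σ ξ : ℝ} {f₁ f₂ f₃ : ℝ → ℂ} :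
    ENNReal.ofReal (jap ξ ^ (s + ε + 1)) * ‖∫ ξ₁ : ℝ, ∫ ξ₂ : ℝ,
      (if ξ < ξ₁ then
        ((jap (Φbo ξ ξ₁ ξ₂) ^ (-σ) * ((ξ₂ + (ξ - ξ₁ - ξ₂)) * (ξ - ξ₁ - ξ₂)) : ℝ) : ℂ) *
          f₁ ξ₁ * f₂ ξ₂ * f₃ (ξ - ξ₁ - ξ₂)
      else 0)‖ₑ ≤
    ∫⁻ ξ₁, ∫⁻ ξ₂,
      (if ξ < ξ₁ then ENNReal.ofReal (cubicKernel s ε σ ξ ξ₁ ξ₂) else 0) *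
      ((ENNReal.ofReal (jap ξ₁ ^ (s + 1)) * ‖f₁ ξ₁‖ₑ) *
        (ENNReal.ofReal (jap ξ₂ ^ (s + 1)) * ‖f₂ ξ₂‖ₑ) *
        (ENNReal.ofReal (jap (ξ - ξ₁ - ξ₂) ^ (s + 1)) * ‖f₃ (ξ - ξ₁ - ξ₂)‖ₑ)) := by
  refine (mul_le_mul_right ((enorm_integral_le_lintegral_enorm _).trans
    (lintegral_mono fun ξ₁ => enorm_integral_le_lintegral_enorm _)) _).trans ?_
  rw [← lintegral_const_mul' _ _ ENNReal.ofReal_ne_top]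
  refine lintegral_mono fun ξ₁ => ?_
  rw [← lintegral_const_mul' _ _ ENNReal.ofReal_ne_top]
  refine lintegral_mono fun ξ₂ => ?_
  split_ifs with h
  · have h0 := jap_pos ξ; have h1 := jap_pos ξ₁; have h2 := jap_pos ξ₂
    have h3 := jap_pos (ξ - ξ₁ - ξ₂); have h4 := jap_pos (Φbo ξ ξ₁ ξ₂)
    have hc : ∀ z : ℂ, ‖z‖ₑ = ENNReal.ofReal ‖z‖ := fun z => (ofReal_norm z).symm
    simp only [hc]
    have hK : 0 ≤ cubicKernel s ε σ ξ ξ₁ ξ₂ := by unfold cubicKernel; positivity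
    repeat rw [← ENNReal.ofReal_mul (by positivity)]
    refine ENNReal.ofReal_le_ofReal (le_of_eq ?_)
    have e1 : ∀ x, 0 < jap x → jap x ^ (-(s + 1)) * jap x ^ (s + 1) = 1 := fun x hx => by
      rw [← Real.rpow_add hx, neg_add_cancel, Real.rpow_zero]
    simp only [norm_mul, Complex.norm_real, Real.norm_eq_abs, abs_of_pos (Real.rpow_pos_of_pos h4 _), cubicKernel]
    calc _ = jap ξ ^ (s + ε + 1) * (jap (Φbo ξ ξ₁ ξ₂) ^ (-σ) *
          (|ξ₂ + (ξ - ξ₁ - ξ₂)| * |ξ - ξ₁ - ξ₂|)) *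
          (jap ξ₁ ^ (-(s + 1)) * jap ξ₁ ^ (s + 1)) *
          (jap ξ₂ ^ (-(s + 1)) * jap ξ₂ ^ (s + 1)) *
          (jap (ξ - ξ₁ - ξ₂) ^ (-(s + 1)) * jap (ξ - ξ₁ - ξ₂) ^ (s + 1)) *
          (‖f₁ ξ₁‖ * ‖f₂ ξ₂‖ * ‖f₃ (ξ - ξ₁ - ξ₂)‖) := by
            rw [e1 _ h1, e1 _ h2, e1 _ h3]; ring
      _ = _ := by ring
  · simp

lemma lintegral_phaseWeighted_le {s ε σ : ℝ} {C : ℝ≥0∞}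
    (hC : ∀ ξ : ℝ, 1 < ξ →
      ∫⁻ ξ₁ in Set.Ioi ξ, ∫⁻ ξ₂, ENNReal.ofReal (cubicKernel s ε σ ξ ξ₁ ξ₂ ^ 2) ≤ C)
    {f₁ f₂ f₃ : ℝ → ℂ} (hf₁ : Measurable f₁) (hf₂ : Measurable f₂) (hf₃ : Measurable f₃) :
    sobNorm (s + ε + 1) (fun ξ : ℝ =>
      if 1 < ξ then
        ∫ ξ₁ : ℝ, ∫ ξ₂ : ℝ,
          (if ξ < ξ₁ then
            ((jap (Φbo ξ ξ₁ ξ₂) ^ (-σ) * ((ξ₂ + (ξ - ξ₁ - ξ₂)) * (ξ - ξ₁ - ξ₂)) : ℝ) : ℂ) *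
              f₁ ξ₁ * f₂ ξ₂ * f₃ (ξ - ξ₁ - ξ₂)
          else 0)
      else 0) ^ 2 ≤
    C * (sobNorm (s + 1) f₁ ^ 2 * sobNorm (s + 1) f₂ ^ 2 * sobNorm (s + 1) f₃ ^ 2) := by
  set G : (ℝ → ℂ) → ℝ → ℝ≥0∞ := fun f x => ENNReal.ofReal (jap x ^ (s + 1)) * ‖f x‖ₑ
    with hG
  have hGm : ∀ f : ℝ → ℂ, Measurable f → Measurable (G f) := fun f hf =>
    (continuous_jap_rpow _).measurable.ennreal_ofReal.mul hf.enorm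
  have m₁ := hGm f₁ hf₁
  have m₂ := hGm f₂ hf₂
  have m₃ := hGm f₃ hf₃
  have hmeas : Measurable fun ξ => ∫⁻ ξ₁, ∫⁻ ξ₂,
      G f₁ ξ₁ ^ 2 * G f₂ ξ₂ ^ 2 * G f₃ (ξ - ξ₁ - ξ₂) ^ 2 := by
    refine Measurable.lintegral_prod_right' (f := fun q : ℝ × ℝ => ∫⁻ ξ₂,
      G f₁ q.2 ^ 2 * G f₂ ξ₂ ^ 2 * G f₃ (q.1 - q.2 - ξ₂) ^ 2) ?_
    exact Measurable.lintegral_prod_right' (f := fun p : (ℝ × ℝ) × ℝ =>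
      G f₁ p.1.2 ^ 2 * G f₂ p.2 ^ 2 * G f₃ (p.1.1 - p.1.2 - p.2) ^ 2) (by fun_prop)
  rw [sobNorm_sq, sobNorm_sq, sobNorm_sq, sobNorm_sq,
    ← lintegral_convolution_triple (m₁.pow_const 2) (m₂.pow_const 2) (m₃.pow_const 2),
    ← lintegral_const_mul _ hmeas]
  refine lintegral_mono fun ξ => ?_
  by_cases hξ : 1 < ξ
  swap
  · simp [hξ]
  simp only [if_pos hξ]
  refine (pow_le_pow_left' enorm_phaseWeighted_le 2).trans ?_
  refine (sq_lintegral_lintegral_mul_le (U := fun ξ₁ ξ₂ =>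
    if ξ < ξ₁ then ENNReal.ofReal (cubicKernel s ε σ ξ ξ₁ ξ₂) else 0)
    (V := fun ξ₁ ξ₂ => G f₁ ξ₁ * G f₂ ξ₂ * G f₃ (ξ - ξ₁ - ξ₂)) ?_ ?_).trans ?_
  · exact Measurable.ite (measurableSet_lt measurable_const measurable_fst)
      (measurable_cubicKernel s ε σ ξ).ennreal_ofReal measurable_const
  · simp only [Function.uncurry_def]
    fun_prop
  · simp only [mul_pow (G f₁ _ * _), mul_pow (G f₁ _)]
    gcongr
    refine le_of_eq_of_le ?_ (hC ξ hξ)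
    rw [← lintegral_indicator measurableSet_Ioi]
    refine lintegral_congr fun ξ₁ => ?_
    by_cases h : ξ < ξ₁
    · rw [Set.indicator_of_mem (show ξ₁ ∈ Set.Ioi ξ from h)]
      refine lintegral_congr fun ξ₂ => ?_
      rw [if_pos h, ENNReal.ofReal_pow]
      have h0 := jap_pos ξ; have h1 := jap_pos ξ₁; have h2 := jap_pos ξ₂
      have h3 := jap_pos (ξ - ξ₁ - ξ₂); have h4 := jap_pos (Φbo ξ ξ₁ ξ₂)
      unfold cubicKernel; positivity
    · simp [h]

/-- Phase-weighted (smoothing) estimate `(Bound_{σ,ε})` for the cubic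
nonlinearity of the gauged Benjamin–Ono equation. -/
theorem phase_weighted_cubic (s ε σ : ℝ) (hs : 0 < s) (hε0 : 0 ≤ ε)
    (hε : ε < min s (3 / 4)) (γ : ℝ)
    (hγ : γ = max (max (1 / 4 + (ε - s) / 2) (ε - 1 / 2)) 0)
    (hσl : γ + 1 / 2 < σ) (hσr : σ < 1) :
    ∃ C : ℝ, 0 < C ∧ ∀ f₁ f₂ f₃ : ℝ → ℂ,
      Measurable f₁ → Measurable f₂ → Measurable f₃ →
      sobNorm (s + 1) f₁ < ⊤ → sobNorm (s + 1) f₂ < ⊤ → sobNorm (s + 1) f₃ < ⊤ →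
      sobNorm (s + ε + 1) (fun ξ : ℝ =>
        if 1 < ξ then
          ∫ ξ₁ : ℝ, ∫ ξ₂ : ℝ,
            (if ξ < ξ₁ then
              ((jap (Φbo ξ ξ₁ ξ₂) ^ (-σ) * ((ξ₂ + (ξ - ξ₁ - ξ₂)) * (ξ - ξ₁ - ξ₂)) : ℝ) : ℂ) *
                f₁ ξ₁ * f₂ ξ₂ * f₃ (ξ - ξ₁ - ξ₂)
            else 0)
        else 0)
      ≤ ENNReal.ofReal C *
          sobNorm (s + 1) f₁ * sobNorm (s + 1) f₂ * sobNorm (s + 1) f₃ := by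
  have hεs : ε < s := hε.trans_le (min_le_left _ _)
  have hε' : ε < 3 / 4 := hε.trans_le (min_le_right _ _)
  have hγ1 : 1 / 4 + (ε - s) / 2 ≤ γ := by rw [hγ]; exact le_max_of_le_left (le_max_left _ _)
  have hγ2 : ε - 1 / 2 ≤ γ := by rw [hγ]; exact le_max_of_le_left (le_max_right _ _)
  have hγ3 : 0 ≤ γ := by rw [hγ]; exact le_max_right _ _
  have hη : 0 < min s (3 / 4) := lt_min hs (by norm_num)
  have hηs : min s (3 / 4) ≤ s := min_le_left _ _
  have hη34 : min s (3 / 4) ≤ 3 / 4 := min_le_right _ _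
  obtain ⟨C, hC, hbound⟩ := exists_lintegral_cubicKernel_sq_le (s := s) (ε := ε) (σ := σ)
    (θ := max 0 (3 / 2 + ε - 2 * σ)) (η := (ε + min s (3 / 4)) / 2) hε0 (by linarith)
    (le_max_left _ _) (max_le hs.le (by linarith))
    (by linarith [le_max_right 0 (3 / 2 + ε - 2 * σ)])
    (by rcases max_choice 0 (3 / 2 + ε - 2 * σ) with h | h <;> rw [h] <;> linarith)
    (by linarith) (by linarith) (by linarith) (by linarith)
  refine ⟨C.toReal.sqrt + 1, by positivity, fun f₁ f₂ f₃ hf₁ hf₂ hf₃ _ _ _ => ?_⟩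
  refine (ENNReal.pow_le_pow_left_iff two_ne_zero).mp ?_
  refine (lintegral_phaseWeighted_le hbound hf₁ hf₂ hf₃).trans ?_
  rw [mul_pow, mul_pow, mul_pow, ← mul_assoc, ← mul_assoc]
  gcongr
  rw [← ENNReal.ofReal_pow (by positivity), ← ENNReal.ofReal_toReal hC]
  refine ENNReal.ofReal_le_ofReal ?_
  rw [ENNReal.toReal_ofReal ENNReal.toReal_nonneg]
  nlinarith [Real.sq_sqrt (ENNReal.toReal_nonneg (a := C)), Real.sqrt_nonneg C.toReal]
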